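/- The set Δ_P⁰ is a neighborhood of 0 in P_ℚ: there exists ε > 0 such that every γ ∈ P_ℚ with ‖γ‖ < ε belongs to Δ_P⁰. -/

import Mathlib

open scoped Pointwise

/-- The subgroup `P^gp` of `ℚ^r` generated by the submonoid `P`. -/
def Pgp {r : ℕ} (P : AddSubmonoid (Fin r → ℚ)) : AddSubgroup (Fin r → ℚ) :=
  AddSubgroup.closure (P : Set (Fin r → ℚ))

/-- The rational cone `P_ℚ` generated by `P`. -/
def PQ {r : ℕ} (P : AddSubmonoid (Fin r → ℚ)) : Set (Fin r → ℚ) :=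
  {v | ∃ n : ℕ, 0 < n ∧ n • v ∈ P}

/-- `P⁺ = P \ {0}`. -/
def Pplus {r : ℕ} (P : AddSubmonoid (Fin r → ℚ)) : Set (Fin r → ℚ) :=
  (P : Set (Fin r → ℚ)) \ {0}

/-- `Δ_P = P_ℚ \ (P⁺ + P_ℚ)`. -/
def Delta {r : ℕ} (P : AddSubmonoid (Fin r → ℚ)) : Set (Fin r → ℚ) :=
  PQ P \ (Pplus P + PQ P)

/-- `Δ_P⁰ = {γ ∈ Δ_P | (γ + P^gp) ∩ Δ_P = {γ}}`. -/
def Delta0 {r : ℕ} (P : AddSubmonoid (Fin r → ℚ)) : Set (Fin r → ℚ) :=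
  {γ | γ ∈ Delta P ∧ {δ | δ ∈ Delta P ∧ δ - γ ∈ Pgp P} = {γ}}

/-- **Minkowski–Weyl**, by Fourier–Motzkin elimination: a finitely generated cone is cut out by
finitely many linear inequalities. -/
lemma PointedCone.exists_finite_mem_hull_iff {K V : Type*} [Field K] [LinearOrder K]
    [IsStrictOrderedRing K] [AddCommGroup V] [Module K V] [Module.Finite K V] (s : Finset V) :
    ∃ F : Set (Module.Dual K V), F.Finite ∧
      ∀ x, x ∈ PointedCone.hull K (s : Set V) ↔ ∀ f ∈ F, 0 ≤ f x := by
  classical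
  induction s using Finset.induction_on with
  | empty =>
    let b := Module.finBasis K V
    refine ⟨Set.range b.coord ∪ Set.range fun i => -b.coord i,
      (Set.finite_range _).union (Set.finite_range _), fun x => ?_⟩
    simp only [Finset.coe_empty, PointedCone.hull, Submodule.span_empty, Submodule.mem_bot]
    constructor
    · rintro rfl f -
      simp
    · intro h
      refine b.forall_coord_eq_zero_iff.1 fun i => le_antisymm ?_ ?_
      · simpa using h (-b.coord i) (Or.inr ⟨i, rfl⟩)
      · exact h (b.coord i) (Or.inl ⟨i, rfl⟩)
  | insert w s _ ih =>
    obtain ⟨F, hF, hmem⟩ := ih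
    refine ⟨{f ∈ F | 0 ≤ f w} ∪
      Set.image2 (fun f g => g w • f - f w • g) {f ∈ F | f w < 0} {g ∈ F | 0 < g w},
      (hF.sep _).union ((hF.sep _).image2 _ (hF.sep _)), fun x => ?_⟩
    rw [Finset.coe_insert, PointedCone.hull, Submodule.mem_span_insert]
    constructor
    · rintro ⟨⟨t, ht⟩, z, hz, rfl⟩ f hf
      have hz := (hmem z).1 hz
      rcases hf with ⟨hfF, hfw⟩ | ⟨f, ⟨hfF, hfw⟩, g, ⟨hgF, hgw⟩, rfl⟩
      · have := mul_nonneg ht hfw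
        have := hz f hfF
        simp only [Nonneg.mk_smul, map_add, map_smul, smul_eq_mul]
        linarith
      · have h₁ := mul_nonneg hgw.le (hz f hfF)
        have h₂ := mul_nonneg (neg_nonneg.2 hfw.le) (hz g hgF)
        simp only [Nonneg.mk_smul, map_add, map_smul, smul_eq_mul, LinearMap.sub_apply,
          LinearMap.smul_apply]
        linarith
    · intro h
      obtain ⟨t, htT, ht⟩ := Set.exists_max_image
        (insert 0 ((fun f : Module.Dual K V => f x / f w) '' {f ∈ F | f w < 0})) id
        (((hF.sep _).image _).insert _) ⟨0, Set.mem_insert _ _⟩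
      have ht₀ : 0 ≤ t := ht 0 (Set.mem_insert _ _)
      refine ⟨⟨t, ht₀⟩, x - t • w, (hmem _).2 fun f hf => ?_, by simp [Nonneg.mk_smul]⟩
      rw [map_sub, map_smul, smul_eq_mul, sub_nonneg]
      rcases lt_trichotomy (f w) 0 with hfw | hfw | hfw
      · exact (div_le_iff_of_neg hfw).1 (ht _ (Or.inr ⟨f, ⟨hf, hfw⟩, rfl⟩))
      · simpa [hfw] using h f (Or.inl ⟨hf, hfw.ge⟩)
      · rcases htT with rfl | ⟨g, ⟨hgF, hgw⟩, rfl⟩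
        · simpa using h f (Or.inl ⟨hf, hfw.le⟩)
        · have := h _ (Or.inr ⟨g, ⟨hgF, hgw⟩, f, ⟨hf, hfw⟩, rfl⟩)
          simp only [LinearMap.sub_apply, LinearMap.smul_apply, smul_eq_mul] at this
          show g x / g w * f w ≤ f x
          rw [div_mul_eq_mul_div, div_le_iff_of_neg hgw]
          linarith

/-- A rational functional takes discrete values on a finitely generated subgroup. -/
lemma exists_pos_forall_mem_closure_le {V : Type*} [AddCommGroup V] [Module ℚ V] (s : Finset V)
    (f : Module.Dual ℚ V) :
    ∃ c : ℚ, 0 < c ∧ ∀ x ∈ AddSubgroup.closure (s : Set V), 0 < f x → c ≤ f x := by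
  obtain ⟨N, hN₀, hN⟩ : ∃ N : ℕ, 0 < N ∧ ∀ x ∈ s, (f x).den ∣ N :=
    ⟨∏ x ∈ s, (f x).den, Finset.prod_pos fun x _ => (f x).den_pos,
      fun x hx => Finset.dvd_prod_of_mem _ hx⟩
  have hN₀' : (0 : ℚ) < N := by exact_mod_cast hN₀
  have hint : ∀ x ∈ AddSubgroup.closure (s : Set V), ∃ z : ℤ, N * f x = z := by
    intro x hx
    induction hx using AddSubgroup.closure_induction with
    | mem x hx =>
      obtain ⟨k, hk⟩ := hN x hx
      refine ⟨k * (f x).num, ?_⟩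
      have := Rat.den_mul_eq_num (f x)
      rw [hk]
      push_cast
      rw [← this]
      ring
    | zero => exact ⟨0, by simp⟩
    | add x y _ _ hx hy =>
      obtain ⟨a, ha⟩ := hx
      obtain ⟨b, hb⟩ := hy
      exact ⟨a + b, by simp [mul_add, ha, hb]⟩
    | neg x _ hx =>
      obtain ⟨a, ha⟩ := hx
      exact ⟨-a, by simp [ha]⟩
  refine ⟨1 / N, by positivity, fun x hx hfx => ?_⟩
  obtain ⟨z, hz⟩ := hint x hx
  have hz₀ : (0 : ℚ) < z := hz ▸ mul_pos hN₀' hfx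
  have hz₁ : (1 : ℚ) ≤ z := by exact_mod_cast Int.add_one_le_iff.2 (Int.cast_pos.1 hz₀)
  rw [div_le_iff₀ hN₀']
  linarith

section RationalCone

variable {r : ℕ} {P : AddSubmonoid (Fin r → ℚ)}

lemma subset_PQ : (P : Set (Fin r → ℚ)) ⊆ PQ P :=
  fun x hx => ⟨1, one_pos, by simpa using hx⟩

lemma add_mem_PQ {x y : Fin r → ℚ} (hx : x ∈ PQ P) (hy : y ∈ PQ P) : x + y ∈ PQ P := by
  obtain ⟨m, hm, hmx⟩ := hx
  obtain ⟨n, hn, hny⟩ := hy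
  refine ⟨m * n, Nat.mul_pos hm hn, ?_⟩
  rw [smul_add, mul_comm m n, mul_smul, mul_comm n m, mul_smul]
  exact P.add_mem (P.nsmul_mem hmx n) (P.nsmul_mem hny m)

lemma smul_mem_PQ {q : ℚ} (hq : 0 ≤ q) {x : Fin r → ℚ} (hx : x ∈ PQ P) : q • x ∈ PQ P := by
  obtain ⟨n, hn, hnx⟩ := hx
  refine ⟨q.den * n, Nat.mul_pos q.den_pos hn, ?_⟩
  have hnum : ((q.num.toNat : ℕ) : ℚ) = q.num := by
    exact_mod_cast Int.toNat_of_nonneg (Rat.num_nonneg.2 hq)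
  have : (q.den * n) • (q • x) = q.num.toNat • (n • x) := by
    simp only [← Nat.cast_smul_eq_nsmul ℚ, smul_smul]
    rw [hnum, ← Rat.den_mul_eq_num q]
    push_cast
    congr 1
    ring
  rw [this]
  exact P.nsmul_mem hnx _

lemma mem_PQ_iff_mem_hull {s : Finset (Fin r → ℚ)}
    (hs : AddSubmonoid.closure (s : Set (Fin r → ℚ)) = P) {x : Fin r → ℚ} :
    x ∈ PQ P ↔ x ∈ PointedCone.hull ℚ (s : Set (Fin r → ℚ)) := by
  constructor
  · rintro ⟨n, hn, hx⟩
    have hle : P ≤ (PointedCone.hull ℚ (s : Set (Fin r → ℚ))).toAddSubmonoid :=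
      hs ▸ AddSubmonoid.closure_le.2 Submodule.subset_span
    have h := Submodule.smul_mem (PointedCone.hull ℚ (s : Set (Fin r → ℚ)))
      (⟨(n : ℚ)⁻¹, by positivity⟩ : {c : ℚ // 0 ≤ c}) (hle hx)
    convert h using 1
    have : (n : ℚ) ≠ 0 := by positivity
    ext i
    simp [Nonneg.mk_smul, this]
  · intro hx
    induction hx using Submodule.span_induction with
    | mem x hx => exact subset_PQ (hs ▸ AddSubmonoid.subset_closure hx)
    | zero => exact subset_PQ P.zero_mem
    | add x y _ _ hx hy => exact add_mem_PQ hx hy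
    | smul c x _ hx => exact smul_mem_PQ c.2 hx

end RationalCone

/-- `Δ_P⁰` is a neighborhood of `0` in `P_ℚ`. -/
theorem delta0_nhds_zero {r : ℕ} (hr : 0 < r) (P : AddSubmonoid (Fin r → ℚ))
    (hfg : P.FG)
    (hsharp : ∀ v : Fin r → ℚ, v ∈ P → -v ∈ P → v = 0)
    (hsat : ∀ v : Fin r → ℚ, v ∈ Pgp P → (∃ n : ℕ, 0 < n ∧ n • v ∈ P) → v ∈ P)
    (hspan : Submodule.span ℚ (P : Set (Fin r → ℚ)) = ⊤) :
    ∃ ε : ℝ, 0 < ε ∧ ∀ γ ∈ PQ P, ‖γ‖ < ε → γ ∈ Delta0 P := by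
  obtain ⟨s, hs⟩ := hfg
  obtain ⟨F, hF, hmem⟩ := PointedCone.exists_finite_mem_hull_iff (K := ℚ) s
  have hPQ : ∀ x, x ∈ PQ P ↔ ∀ f ∈ F, 0 ≤ f x :=
    fun x => (mem_PQ_iff_mem_hull hs).trans (hmem x)
  have hgp : ∀ x ∈ Pgp P, x ∈ AddSubgroup.closure (s : Set (Fin r → ℚ)) := by
    have : P ≤ (AddSubgroup.closure (s : Set (Fin r → ℚ))).toAddSubmonoid :=
      hs ▸ AddSubmonoid.closure_le.2 AddSubgroup.subset_closure
    exact (AddSubgroup.closure_le _).2 this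
  choose c hc₀ hc using fun f : Module.Dual ℚ (Fin r → ℚ) => exists_pos_forall_mem_closure_le s f
  have hnhds : ∀ᶠ γ in nhds (0 : Fin r → ℚ), ∀ f ∈ F, f γ < c f := by
    refine (Filter.eventually_all_finite hF).2 fun f _ => ?_
    have hcont : Continuous f := LinearMap.continuous_on_pi f
    exact hcont.continuousAt.eventually_lt continuousAt_const (by simpa using hc₀ f)
  obtain ⟨ε, hε, hball⟩ := Metric.eventually_nhds_iff.1 hnhds
  refine ⟨ε, hε, fun γ hγ hγε => ?_⟩
  have hsmall : ∀ f ∈ F, f γ < c f := hball (by simpa using hγε)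
  have hPgp : ∀ x ∈ P, x ∈ Pgp P := fun x hx => AddSubgroup.subset_closure hx
  have hγΔ : γ ∈ Delta P := by
    refine ⟨hγ, ?_⟩
    rintro ⟨p, ⟨hp, hp₀⟩, q, hq, rfl⟩
    refine hp₀ (hsharp p hp (hsat _ (neg_mem (hPgp p hp)) ((hPQ _).2 fun f hf => ?_)))
    rw [map_neg, neg_nonneg]
    by_contra! hfp
    have h₁ := hc f p (hgp p (hPgp p hp)) hfp
    have h₂ := hsmall f hf
    have h₃ := (hPQ q).1 hq f hf
    rw [map_add] at h₂
    linarith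
  refine ⟨hγΔ, Set.Subset.antisymm ?_ ?_⟩
  · rintro δ ⟨hδ, hδγ⟩
    have hP : δ - γ ∈ P := hsat _ hδγ <| (hPQ _).2 fun f hf => by
      by_contra! hneg
      have h₁ := hc f (-(δ - γ)) (hgp _ (neg_mem hδγ)) (by rw [map_neg]; linarith)
      have h₂ := hsmall f hf
      have h₃ := (hPQ δ).1 hδ.1 f hf
      rw [map_neg, map_sub] at h₁
      linarith
    by_contra hne
    exact hδ.2 ⟨δ - γ, ⟨hP, fun h => hne (sub_eq_zero.1 h)⟩, γ, hγ, sub_add_cancel _ _⟩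
  · rintro _ rfl
    exact ⟨hγΔ, by simp [zero_mem]⟩
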